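/- arXiv:1612.00628 — 3 statements merged into one kernel-verified Lean document; each statement's English description precedes it below -/
import Mathlib

section
/- Let $K \geq 1$ be an integer, $\alpha \in [0,1]$, and let $S$ be a nonempty subset of $\{1,\ldots,K\}$. For a tuple $(d_1,\ldots,d_K)$ of nonnegative reals, the following two sets of conditions are equivalent: (i) $\sum_{i \in S} d_i = 1 + (|S|-1)\alpha$ and $\sum_{i \in \bar{S}} d_i \leq 1 + (|\bar{S}|-1)\alpha$ for every nonempty subset $\bar{S} \subseteq \{1,\ldots,K\}$; (ii) $\sum_{i \in S} d_i = 1 + (|S|-1)\alpha$, $d_i \geq \alpha$ for all $i \in S$, and $d_i \leq \alpha$ for all $i \in \{1,\ldots,K\} \setminus S$. -/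
/-- If `f` is nonnegative on `S` and nonpositive off `S`, then `S` maximizes `T ↦ ∑ i ∈ T, f i`. -/
theorem Finset.sum_le_sum_of_nonneg_of_nonpos {ι : Type*} [DecidableEq ι] {f : ι → ℝ}
    {S : Finset ι} (hpos : ∀ i ∈ S, 0 ≤ f i) (hneg : ∀ i ∉ S, f i ≤ 0) (T : Finset ι) :
    ∑ i ∈ T, f i ≤ ∑ i ∈ S, f i := by
  have hsplit := Finset.sum_inter_add_sum_sdiff T S f
  have hdiff : ∑ i ∈ T \ S, f i ≤ 0 :=
    Finset.sum_nonpos fun i hi => hneg i (Finset.mem_sdiff.1 hi).2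
  have hinter : ∑ i ∈ T ∩ S, f i ≤ ∑ i ∈ S, f i :=
    Finset.sum_le_sum_of_subset_of_nonneg Finset.inter_subset_right fun i hi _ => hpos i hi
  linarith


/-- Characterization of the facet of the region `𝒟_{M=K}(α)` lying on the hyperplane
`∑_{i ∈ S} d_i = 1 + (|S|-1)α`. -/
theorem facet_characterization_MK
    (K : ℕ) (hK : 1 ≤ K) (α : ℝ) (hα : α ∈ Set.Icc (0 : ℝ) 1)
    (S : Finset (Fin K)) (hS : S.Nonempty)
    (d : Fin K → ℝ) (hd : ∀ i, 0 ≤ d i) :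
    ((∑ i ∈ S, d i = 1 + ((S.card : ℝ) - 1) * α) ∧
      (∀ T : Finset (Fin K), T.Nonempty →
        ∑ i ∈ T, d i ≤ 1 + ((T.card : ℝ) - 1) * α))
    ↔
    ((∑ i ∈ S, d i = 1 + ((S.card : ℝ) - 1) * α) ∧
      (∀ i ∈ S, α ≤ d i) ∧
      (∀ i ∉ S, d i ≤ α)) := by
  refine and_congr_right fun hsum => ⟨fun h => ⟨fun i hi => ?_, fun i hi => ?_⟩, ?_⟩
  · have herase := Finset.add_sum_erase S d hi
    have hcard : ((S.erase i).card : ℝ) + 1 = S.card := by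
      exact_mod_cast Finset.card_erase_add_one hi
    rcases (S.erase i).eq_empty_or_nonempty with he | he
    · rw [he] at herase hcard
      simp only [Finset.sum_empty, Finset.card_empty, Nat.cast_zero] at herase hcard
      rw [← hcard] at hsum
      linarith [hα.2]
    · have := h _ he
      rw [← hcard] at hsum
      linarith
  · have := h (insert i S) (Finset.insert_nonempty i S)
    rw [Finset.sum_insert hi, Finset.card_insert_of_notMem hi] at this
    push_cast at this
    linarith
  · rintro ⟨hge, hle⟩ T -
    have := Finset.sum_le_sum_of_nonneg_of_nonpos (f := fun i => d i - α)
      (fun i hi => sub_nonneg.2 (hge i hi)) (fun i hi => sub_nonpos.2 (hle i hi)) T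
    simp only [Finset.sum_sub_distrib, Finset.sum_const, nsmul_eq_mul] at this
    linarith
end

section
/- Let $M \geq 1$ and $K > M$ be integers and $\alpha, \beta \in [0,1]$. The tuple $(d_1,\ldots,d_K)$ given by $d_k = \frac{\beta + (M-1)\min\{\alpha,\beta\}}{M}$ for $k \in \{1,\ldots,M\}$ and $d_k = \frac{1-\beta}{K-M}$ for $k \in \{M+1,\ldots,K\}$ belongs to the region $\mathcal{D}$; that is, for every nonempty subset $S \subseteq \{1,\ldots,M\}$, $|S|\cdot\frac{\beta + (M-1)\min\{\alpha,\beta\}}{M} + (1-\beta) \leq 1 + (|S|-1)\alpha$. -/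
/-- The symmetric DoF tuple of the power partitioning scheme with power partition `β`
belongs to the region `𝒟`: for every nonempty `S ⊆ {1,…,M}`,
`|S| ⬝ (β + (M-1) min{α,β})/M + (1-β) ≤ 1 + (|S|-1)α`. -/
theorem power_partitioning_tuple_in_region
    (M K : ℕ) (hM : 1 ≤ M) (hMK : M < K) (α β : ℝ)
    (hα : α ∈ Set.Icc (0 : ℝ) 1) (hβ : β ∈ Set.Icc (0 : ℝ) 1)
    (d : ℕ → ℝ)
    (hdα : ∀ k ∈ Finset.Icc 1 M, d k = (β + ((M : ℝ) - 1) * min α β) / M)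
    (hd0 : ∀ k ∈ Finset.Icc (M + 1) K, d k = (1 - β) / ((K : ℝ) - M)) :
    ∀ S ⊆ Finset.Icc 1 M, S.Nonempty →
      ∑ k ∈ S, d k + ∑ k ∈ Finset.Icc (M + 1) K, d k ≤ 1 + ((S.card : ℝ) - 1) * α := by
  intro S hS hne
  have hM0 : (0 : ℝ) < M := by exact_mod_cast hM
  have hKM : (0 : ℝ) < (K : ℝ) - M := sub_pos.mpr (by exact_mod_cast hMK)
  have hS1 : (1 : ℝ) ≤ S.card := by exact_mod_cast hne.card_pos
  have hSM : (S.card : ℝ) ≤ M := by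
    exact_mod_cast (Finset.card_le_card hS).trans_eq (by simp)
  have hsumS : ∑ k ∈ S, d k = S.card * ((β + ((M : ℝ) - 1) * min α β) / M) := by
    rw [Finset.sum_congr rfl fun k hk => hdα k (hS hk), Finset.sum_const, nsmul_eq_mul]
  have hsum0 : ∑ k ∈ Finset.Icc (M + 1) K, d k = 1 - β := by
    rw [Finset.sum_congr rfl hd0, Finset.sum_const, nsmul_eq_mul, Nat.card_Icc,
      Nat.add_sub_add_right, Nat.cast_sub hMK.le, mul_div_cancel₀ _ hKM.ne']
  have hsplit : S.card * ((β + ((M : ℝ) - 1) * min α β) / M)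
      = S.card * min α β + S.card / M * (β - min α β) := by
    field_simp
    ring
  have hratio : S.card / (M : ℝ) * (β - min α β) ≤ β - min α β :=
    mul_le_of_le_one_left (sub_nonneg.mpr (min_le_right α β)) ((div_le_one hM0).mpr hSM)
  have hmin : ((S.card : ℝ) - 1) * min α β ≤ ((S.card : ℝ) - 1) * α :=
    mul_le_mul_of_nonneg_left (min_le_left α β) (sub_nonneg.mpr hS1)
  rw [hsumS, hsum0, hsplit]
  linarith
end

section
/- Let $M \geq 1$ and $K > M$ be integers, $\alpha \in [0,1]$ and $b \in [0,1]$. The power partitioning DoF tuple with $\beta = b$, namely $d_k^{(pp)} = \frac{b + (M-1)\min\{\alpha,b\}}{M}$ for $k \in \{1,\ldots,M\}$ and $d_k^{(pp)} = \frac{1-b}{K-M}$ for $k \in \{M+1,\ldots,K\}$, componentwise dominates the time partitioning DoF tuple $d_k^{(tp)} = b\,\frac{1+(M-1)\alpha}{M}$ for $k \in \{1,\ldots,M\}$ and $d_k^{(tp)} = \frac{1-b}{K-M}$ for $k \in \{M+1,\ldots,K\}$: it holds that $d_k^{(pp)} \geq d_k^{(tp)}$ for all $k \in \{1,\ldots,K\}$,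 with equality for $k \in \{M+1,\ldots,K\}$, and with strict inequality for $k \in \{1,\ldots,M\}$ whenever $M \geq 2$, $0 < \alpha < 1$ and $0 < b < 1$. -/
/-- The power partitioning DoF tuple with `β = b` componentwise dominates the time
partitioning DoF tuple with time partition `b`: `d_k^{(pp)} ≥ d_k^{(tp)}` for all users,
with equality for the no-CSIT users `{M+1,…,K}`, and with strict inequality for the
partial-CSIT users `{1,…,M}` whenever `M ≥ 2`, `0 < α < 1` and `0 < b < 1`. -/
theorem power_dominates_time_partitioning
    (M K : ℕ) (hM : 1 ≤ M) (hMK : M < K) (α b : ℝ)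
    (hα : α ∈ Set.Icc (0 : ℝ) 1) (hb : b ∈ Set.Icc (0 : ℝ) 1)
    (dpp dtp : ℕ → ℝ)
    (hpp1 : ∀ k ∈ Finset.Icc 1 M, dpp k = (b + ((M : ℝ) - 1) * min α b) / M)
    (hpp2 : ∀ k ∈ Finset.Icc (M + 1) K, dpp k = (1 - b) / ((K : ℝ) - M))
    (htp1 : ∀ k ∈ Finset.Icc 1 M, dtp k = b * (1 + ((M : ℝ) - 1) * α) / M)
    (htp2 : ∀ k ∈ Finset.Icc (M + 1) K, dtp k = (1 - b) / ((K : ℝ) - M)) :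
    (∀ k ∈ Finset.Icc 1 K, dtp k ≤ dpp k) ∧
    (∀ k ∈ Finset.Icc (M + 1) K, dpp k = dtp k) ∧
    (2 ≤ M → 0 < α → α < 1 → 0 < b → b < 1 →
      ∀ k ∈ Finset.Icc 1 M, dtp k < dpp k) := by
  obtain ⟨hα0, hα1⟩ := hα
  obtain ⟨hb0, hb1⟩ := hb
  have hM' : (1 : ℝ) ≤ M := by exact_mod_cast hM
  have heq : ∀ k ∈ Finset.Icc (M + 1) K, dpp k = dtp k := fun k hk => by
    rw [hpp2 k hk, htp2 k hk]
  refine ⟨fun k hk => ?_, heq, fun hM2 hα0 hα1 hb0 hb1 k hk => ?_⟩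
  · rw [Finset.mem_Icc] at hk
    by_cases hkM : k ≤ M
    · have hk' : k ∈ Finset.Icc 1 M := Finset.mem_Icc.2 ⟨hk.1, hkM⟩
      rw [hpp1 k hk', htp1 k hk']
      have hmin : b * α ≤ min α b :=
        le_min (mul_le_of_le_one_left hα0 hb1) (mul_le_of_le_one_right hb0 hα1)
      have hmul := mul_le_mul_of_nonneg_left hmin (sub_nonneg.2 hM')
      gcongr
      linarith
    · exact (heq k (Finset.mem_Icc.2 ⟨by omega, hk.2⟩)).ge
  · rw [hpp1 k hk, htp1 k hk]
    have hM2' : (1 : ℝ) < M := by exact_mod_cast hM2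
    have hmin : b * α < min α b :=
      lt_min (mul_lt_of_lt_one_left hα0 hb1) (mul_lt_of_lt_one_right hb0 hα1)
    have hmul := mul_lt_mul_of_pos_left hmin (sub_pos.2 hM2')
    gcongr
    linarith
end
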